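/- Let H be a real Hilbert space and R an injective operator with domain dom(R) ⊆ H, so that the inverse operator R⁻¹ is defined on ran(R). Then 0 ∉ SRG(R) and SRG(R⁻¹) = { 1/conj(z) : z ∈ SRG(R) }; since SRG(R) is symmetric under complex conjugation, this set also equals { 1/z : z ∈ SRG(R) }. -/

import Mathlib

open MeasureTheory Complex Set
open scoped ENNReal Classical

/-- The set `z_R(u₁,u₂) = { (‖Ru₁−Ru₂‖/‖u₁−u₂‖)·exp(±i·∠(u₁−u₂, Ru₁−Ru₂)) } ⊆ ℂ`,
with the convention `z_R(u₁,u₂) = {0}` if `Ru₁ = Ru₂`.  Here `∠` is the angle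
`arccos(⟨u,y⟩/(‖u‖·‖y‖))` in a real Hilbert space. -/
noncomputable def zRel {E : Type*} [NormedAddCommGroup E] [InnerProductSpace ℝ E]
    (R : E → E) (u₁ u₂ : E) : Set ℂ :=
  if R u₁ = R u₂ then {0}
  else
    { (‖R u₁ - R u₂‖ / ‖u₁ - u₂‖ : ℝ) *
        Complex.exp ((InnerProductGeometry.angle (u₁ - u₂) (R u₁ - R u₂) : ℝ) * Complex.I),
      (‖R u₁ - R u₂‖ / ‖u₁ - u₂‖ : ℝ) *
        Complex.exp (-((InnerProductGeometry.angle (u₁ - u₂) (R u₁ - R u₂) : ℝ) * Complex.I)) }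

/-- The scaled relative graph of `R` over the input set `D`:
`SRG_D(R) = ⋃_{u₁ ≠ u₂ ∈ D} z_R(u₁,u₂)`. -/
noncomputable def SRG {E : Type*} [NormedAddCommGroup E] [InnerProductSpace ℝ E]
    (D : Set E) (R : E → E) : Set ℂ :=
  ⋃ u₁ ∈ D, ⋃ u₂ ∈ D, ⋃ (_ : u₁ ≠ u₂), zRel R u₁ u₂

section InverseSRG

variable {E : Type*} [NormedAddCommGroup E] [InnerProductSpace ℝ E]

theorem mem_SRG_iff {D : Set E} {R : E → E} {z : ℂ} :
    z ∈ SRG D R ↔ ∃ u₁ ∈ D, ∃ u₂ ∈ D, u₁ ≠ u₂ ∧ z ∈ zRel R u₁ u₂ := by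
  simp only [SRG, Set.mem_iUnion, exists_prop]

theorem conj_mem_zRel {R : E → E} {u₁ u₂ : E} {z : ℂ} (hz : z ∈ zRel R u₁ u₂) :
    (starRingEnd ℂ) z ∈ zRel R u₁ u₂ := by
  unfold zRel at hz ⊢
  split_ifs at hz ⊢
  · simp_all
  · rcases hz with rfl | rfl
    · right
      simp [← Complex.exp_conj]
    · left
      simp [← Complex.exp_conj]

theorem conj_mem_SRG {D : Set E} {R : E → E} {z : ℂ} (hz : z ∈ SRG D R) :
    (starRingEnd ℂ) z ∈ SRG D R := by
  obtain ⟨u₁, h₁, u₂, h₂, hne, hz⟩ := mem_SRG_iff.1 hz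
  exact mem_SRG_iff.2 ⟨u₁, h₁, u₂, h₂, hne, conj_mem_zRel hz⟩

theorem zero_notMem_zRel {R : E → E} {u₁ u₂ : E} (hne : u₁ ≠ u₂) (hR : R u₁ ≠ R u₂) :
    (0 : ℂ) ∉ zRel R u₁ u₂ := by
  simp [zRel, hR, sub_eq_zero, hne, eq_comm (a := (0 : ℂ))]

theorem zRel_leftInverse {R S : E → E} {u₁ u₂ : E} (hne : u₁ ≠ u₂) (hR : R u₁ ≠ R u₂)
    (h₁ : S (R u₁) = u₁) (h₂ : S (R u₂) = u₂) :
    zRel S (R u₁) (R u₂) = (fun z : ℂ => ((starRingEnd ℂ) z)⁻¹) '' zRel R u₁ u₂ := by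
  simp only [zRel, h₁, h₂, if_neg hne, if_neg hR, Set.image_pair]
  rw [InnerProductGeometry.angle_comm (R u₁ - R u₂)]
  simp [← Complex.exp_conj, ← Complex.exp_neg, mul_comm, div_eq_mul_inv]

end InverseSRG

/-- If `R` is injective on its domain `D`, with inverse operator
`Rinv` defined on `ran(R) = R '' D` (so `Rinv (R u) = u` for `u ∈ D`), then
`0 ∉ SRG(R)` and `SRG(R⁻¹) = { 1/conj z : z ∈ SRG(R) }`; since `SRG(R)` is symmetric
under conjugation, this set also equals `{ 1/z : z ∈ SRG(R) }`. -/
theorem statement14 {H : Type*} [NormedAddCommGroup H] [InnerProductSpace ℝ H]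
    (D : Set H) (R : H → H)
    (hinj : ∀ u₁ ∈ D, ∀ u₂ ∈ D, R u₁ = R u₂ → u₁ = u₂)
    (Rinv : H → H) (hRinv : ∀ u ∈ D, Rinv (R u) = u) :
    (0 : ℂ) ∉ SRG D R ∧
    SRG (R '' D) Rinv = (fun z : ℂ => ((starRingEnd ℂ) z)⁻¹) '' SRG D R ∧
    (fun z : ℂ => ((starRingEnd ℂ) z)⁻¹) '' SRG D R =
      (fun z : ℂ => z⁻¹) '' SRG D R := by
  have hne : ∀ u₁ ∈ D, ∀ u₂ ∈ D, u₁ ≠ u₂ → R u₁ ≠ R u₂ :=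
    fun u₁ h₁ u₂ h₂ h hR => h (hinj u₁ h₁ u₂ h₂ hR)
  refine ⟨fun h0 => ?_, ?_, ?_⟩
  · obtain ⟨u₁, h₁, u₂, h₂, h, hz⟩ := mem_SRG_iff.1 h0
    exact zero_notMem_zRel h (hne u₁ h₁ u₂ h₂ h) hz
  · ext w
    constructor
    · intro hw
      obtain ⟨_, ⟨u₁, h₁, rfl⟩, _, ⟨u₂, h₂, rfl⟩, hR, hz⟩ := mem_SRG_iff.1 hw
      have h : u₁ ≠ u₂ := fun h => hR (congrArg R h)
      rw [zRel_leftInverse h hR (hRinv u₁ h₁) (hRinv u₂ h₂)] at hz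
      obtain ⟨z, hz, rfl⟩ := hz
      exact ⟨z, mem_SRG_iff.2 ⟨u₁, h₁, u₂, h₂, h, hz⟩, rfl⟩
    · rintro ⟨z, hz, rfl⟩
      obtain ⟨u₁, h₁, u₂, h₂, h, hz⟩ := mem_SRG_iff.1 hz
      have hR := hne u₁ h₁ u₂ h₂ h
      refine mem_SRG_iff.2 ⟨R u₁, ⟨u₁, h₁, rfl⟩, R u₂, ⟨u₂, h₂, rfl⟩, hR, ?_⟩
      rw [zRel_leftInverse h hR (hRinv u₁ h₁) (hRinv u₂ h₂)]
      exact ⟨z, hz, rfl⟩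
  · ext w
    constructor
    · rintro ⟨z, hz, rfl⟩
      exact ⟨_, conj_mem_SRG hz, rfl⟩
    · rintro ⟨z, hz, rfl⟩
      exact ⟨_, conj_mem_SRG hz, by simp⟩
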